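/- arXiv:2102.04547 — 2 statements merged into one kernel-verified Lean document; each statement's English description precedes it below -/
import Mathlib

section
/- Suppose γ < 1/( L(B/2)(n+1) + L + (L/2)nB ), so that γ^{-1} − L((B/2)(n+1) + 1) − (L/2)nB > 0. Then for all t ≥ B, with α(t) = f(x(t)) − f* and β(t) = γ² Σ_{τ=t−B}^{t−1} ‖s(τ)‖², one has β(t+B) ≤ ( α(t) + (L/2)nB β(t) ) / ( γ^{-1} − L((B/2)(n+1) + 1) − (L/2)nB ). -/
open scoped BigOperators
open Classical

/-- Descent lemma: a function with `L`-Lipschitz gradient lies below its quadratic upper model. -/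
theorem descent_of_lipschitz_gradient {E : Type*} [NormedAddCommGroup E] [InnerProductSpace ℝ E]
    [CompleteSpace E] {f : E → ℝ} {L : ℝ} (hdiff : Differentiable ℝ f)
    (hLip : ∀ y z, ‖gradient f z - gradient f y‖ ≤ L * ‖z - y‖) (x d : E) :
    f (x + d) ≤ f x + inner ℝ (gradient f x) d + L / 2 * ‖d‖ ^ 2 := by
  let φ : ℝ → ℝ := fun u => f (x + u • d) - u * inner ℝ (gradient f x) d - L / 2 * ‖d‖ ^ 2 * u ^ 2
  have hφ (u : ℝ) : HasDerivAt φ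
      (inner ℝ (gradient f (x + u • d) - gradient f x) d - L * ‖d‖ ^ 2 * u) u := by
    have hline : HasDerivAt (fun u : ℝ => x + u • d) d u := by
      simpa using ((hasDerivAt_id u).smul_const d).const_add x
    have hf : HasDerivAt (fun u : ℝ => f (x + u • d)) (inner ℝ (gradient f (x + u • d)) d) u := by
      have h := (hdiff (x + u • d)).hasGradientAt.hasFDerivAt.comp_hasDerivAt u hline
      rwa [InnerProductSpace.toDual_apply_apply] at h
    have h := (hf.sub ((hasDerivAt_id u).mul_const (inner ℝ (gradient f x) d))).sub
      (((hasDerivAt_id u).pow 2).const_mul (L / 2 * ‖d‖ ^ 2))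
    refine h.congr_deriv ?_
    simp only [inner_sub_left, id]
    ring
  have hanti : AntitoneOn φ (Set.Icc 0 1) := by
    refine antitoneOn_of_deriv_nonpos (convex_Icc 0 1)
      (fun u _ => (hφ u).continuousAt.continuousWithinAt)
      (fun u _ => (hφ u).differentiableAt.differentiableWithinAt) fun u hu => ?_
    rw [interior_Icc] at hu
    have hgrad := hLip x (x + u • d)
    rw [add_sub_cancel_left, norm_smul, Real.norm_of_nonneg hu.1.le] at hgrad
    have hinner := real_inner_le_norm (gradient f (x + u • d) - gradient f x) d
    rw [(hφ u).deriv]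
    nlinarith [mul_le_mul_of_nonneg_right hgrad (norm_nonneg d)]
  have h := hanti (Set.left_mem_Icc.2 zero_le_one) (Set.right_mem_Icc.2 zero_le_one) zero_le_one
  simp only [φ, one_smul, zero_smul, add_zero] at h
  linarith

/-- If `x` moves by `γ • s` at each step, then a vector whose coordinates are those of iterates at
most `B` steps old is within a controlled distance of the current iterate. -/
theorem norm_sub_sq_le_of_delayed {ι : Type*} [Fintype ι] {x s : ℕ → EuclideanSpace ℝ ι} {γ : ℝ}
    (hstep : ∀ t, x (t + 1) = x t + γ • s t) {B t : ℕ} {σ : ι → ℕ} (hσ : ∀ c, σ c ≤ t)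
    (hσB : ∀ c, t ≤ σ c + B) {y : EuclideanSpace ℝ ι} (hy : ∀ c, y c = x (σ c) c) :
    ‖x t - y‖ ^ 2 ≤ γ ^ 2 * (B * ∑ v ∈ Finset.Ico (t - B) t, ‖s v‖ ^ 2) := by
  have hcoord (c : ι) : (x t c - y c) ^ 2 ≤
      γ ^ 2 * (B * ∑ v ∈ Finset.Ico (t - B) t, s v c ^ 2) := by
    have hsum : x t c - y c = γ * ∑ v ∈ Finset.Ico (σ c) t, s v c := by
      rw [hy, ← Finset.sum_Ico_sub (fun v => x v c) (hσ c), Finset.mul_sum]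
      refine Finset.sum_congr rfl fun v _ => ?_
      simp [hstep v]
    rw [hsum, mul_pow]
    refine mul_le_mul_of_nonneg_left (sq_sum_le_card_mul_sum_sq.trans ?_) (sq_nonneg γ)
    have hcard : ((Finset.Ico (σ c) t).card : ℝ) ≤ B := by
      rw [Nat.card_Ico]
      exact_mod_cast (by have := hσB c; omega : t - σ c ≤ B)
    refine mul_le_mul hcard (Finset.sum_le_sum_of_subset_of_nonneg ?_ fun _ _ _ => sq_nonneg _)
      (Finset.sum_nonneg fun _ _ => sq_nonneg _) (Nat.cast_nonneg B)
    exact Finset.Ico_subset_Ico_left (by have := hσB c; omega)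
  simp only [EuclideanSpace.real_norm_sq_eq, PiLp.sub_apply]
  refine (Finset.sum_le_sum fun c _ => hcoord c).trans_eq ?_
  rw [← Finset.mul_sum, ← Finset.mul_sum, Finset.sum_comm]

/-- Young's inequality, summed over coordinates, when the vector multiplying `s` is assembled
blockwise: on the block `i`, wherever `s` is nonzero, it agrees with a vector `D i` of squared norm
at most `R`. -/
theorem sum_mul_le_of_block_norm_sq_le {ι : Type*} [Fintype ι] {n : ℕ} {blk : ι → Fin n}
    {A : Fin n → Prop} {D : Fin n → EuclideanSpace ℝ ι} {s : EuclideanSpace ℝ ι} {R K : ℝ}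
    (hK : 0 < K) (hR : 0 ≤ R) (hD : ∀ i, A i → ‖D i‖ ^ 2 ≤ R) (hs : ∀ c, ¬ A (blk c) → s c = 0) :
    ∑ c, D (blk c) c * s c ≤ n * R / (2 * K) + K / 2 * ‖s‖ ^ 2 := by
  have hterm (c : ι) : D (blk c) c * s c ≤
      (if A (blk c) then D (blk c) c ^ 2 else 0) / (2 * K) + K / 2 * s c ^ 2 := by
    split_ifs with h
    · rw [← sub_nonneg]
      have : D (blk c) c ^ 2 / (2 * K) + K / 2 * s c ^ 2 - D (blk c) c * s c =
          (D (blk c) c - K * s c) ^ 2 / (2 * K) := by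
        field_simp
        ring
      rw [this]
      positivity
    · simp [hs c h]
  have hblocks : ∑ c, (if A (blk c) then D (blk c) c ^ 2 else 0) ≤ n * R := by
    rw [← Finset.sum_fiberwise Finset.univ blk]
    refine (Finset.sum_le_card_nsmul Finset.univ _ R fun i _ => ?_).trans_eq (by simp)
    by_cases hA : A i
    · refine le_trans ?_ (hD i hA)
      rw [EuclideanSpace.real_norm_sq_eq, Finset.sum_filter]
      refine Finset.sum_le_sum fun c _ => ?_
      split_ifs with h <;> first | (subst i; exact le_rfl) | exact sq_nonneg _
    · refine (Finset.sum_nonpos fun c hc => ?_).trans hR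
      rw [(Finset.mem_filter.1 hc).2, if_neg hA]
  refine (Finset.sum_le_sum fun c _ => hterm c).trans ?_
  rw [Finset.sum_add_distrib, ← Finset.sum_div, ← Finset.mul_sum, ← EuclideanSpace.real_norm_sq_eq]
  gcongr

/-- A trailing-window sum, summed over the next `B` times, is at most `B` times the total. -/
theorem sum_window_le {a : ℕ → ℝ} (ha : ∀ t, 0 ≤ a t) (B t : ℕ) :
    ∑ u ∈ Finset.Ico t (t + B), ∑ v ∈ Finset.Ico (u - B) u, a v ≤
      B * (∑ v ∈ Finset.Ico (t - B) t, a v + ∑ v ∈ Finset.Ico t (t + B), a v) := by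
  rw [Finset.sum_Ico_consecutive a (Nat.sub_le t B) (Nat.le_add_right t B)]
  refine (Finset.sum_le_card_nsmul _ _ (∑ v ∈ Finset.Ico (t - B) (t + B), a v)
    fun u hu => ?_).trans_eq (by simp)
  rw [Finset.mem_Ico] at hu
  exact Finset.sum_le_sum_of_subset_of_nonneg
    (Finset.Ico_subset_Ico (by omega) (by omega)) fun v _ _ => ha v

theorem beta_shift_bound
    (m n B : ℕ) (hn : 0 < n) (hB : 1 ≤ B)
    (f : EuclideanSpace ℝ (Fin m) → ℝ) (μ L γ fstar : ℝ)
    (hμ : 0 < μ) (hL : 0 < L) (hγ : 0 < γ)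
    (hdiff : Differentiable ℝ f)
    (hmin : ∀ z, fstar ≤ f z) (hattain : ∃ z, f z = fstar)
    (hPL : ∀ z, μ * (f z - fstar) ≤ (1 / 2) * ‖gradient f z‖ ^ 2)
    (hLip : ∀ y z, ‖gradient f z - gradient f y‖ ≤ L * ‖z - y‖)
    (hstatfin : {z : EuclideanSpace ℝ (Fin m) | gradient f z = 0}.Finite)
    (hstatne : {z : EuclideanSpace ℝ (Fin m) | gradient f z = 0}.Nonempty)
    (blk : Fin m → Fin n) (T : Fin n → Set ℕ) (τ : Fin n → Fin n → ℕ → ℕ)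
    (X : Fin n → ℕ → EuclideanSpace ℝ (Fin m))
    (x s : ℕ → EuclideanSpace ℝ (Fin m))
    (hτle : ∀ i j t, τ i j t ≤ t)
    (hread : ∀ i j, j ≠ i → ∀ t c, blk c = j → X i t c = X j (τ i j t) c)
    (hupd : ∀ i t c, blk c = i →
      X i (t + 1) c = if t ∈ T i then X i t c - γ * gradient f (X i t) c else X i t c)
    (hx : ∀ t c, x t c = X (blk c) t c)
    (hs : ∀ t c, s t c = if t ∈ T (blk c) then -(gradient f (X (blk c) t) c) else 0)
    (hasync1 : ∀ i t, ∃ t' ∈ Finset.Ico t (t + B), t' ∈ T i)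
    (hasync2 : ∀ i j t, t ∈ T i → j ≠ i → t < τ i j t + B)
    (alpha beta : ℕ → ℝ)
    (halpha : ∀ t, alpha t = f (x t) - fstar)
    (hbeta : ∀ t, beta t = γ ^ 2 * ∑ τ' ∈ Finset.Ico (t - B) t, ‖s τ'‖ ^ 2)
    (hγ13 : γ < 1 / (L * ((B : ℝ) / 2) * ((n : ℝ) + 1) + L + (L / 2) * (n : ℝ) * (B : ℝ))) :
    ∀ t : ℕ, B ≤ t →
      beta (t + B) ≤ (alpha t + (L / 2) * (n : ℝ) * (B : ℝ) * beta t) /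
        (γ⁻¹ - L * (((B : ℝ) / 2) * ((n : ℝ) + 1) + 1) - (L / 2) * (n : ℝ) * (B : ℝ)) := by
  intro t ht
  have hstep (u : ℕ) : x (u + 1) = x u + γ • s u := by
    ext c
    simp only [PiLp.add_apply, PiLp.smul_apply, smul_eq_mul, hx, hs, hupd _ u c rfl]
    split_ifs <;> ring
  have hB0 : (0 : ℝ) < B := by exact_mod_cast hB
  have hdescent (u : ℕ) : f (x (u + 1)) ≤ f (x u) -
      (γ⁻¹ - L / 2 * (B + 1)) * (γ ^ 2 * ‖s u‖ ^ 2) +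
      L / 2 * n * (γ ^ 2 * ∑ v ∈ Finset.Ico (u - B) u, ‖s v‖ ^ 2) := by
    have hstale (i : Fin n) (hi : u ∈ T i) : ‖x u - X i u‖ ^ 2 ≤
        γ ^ 2 * (B * ∑ v ∈ Finset.Ico (u - B) u, ‖s v‖ ^ 2) := by
      refine norm_sub_sq_le_of_delayed hstep
        (σ := fun c => if blk c = i then u else τ i (blk c) u) (fun c => ?_) (fun c => ?_)
        fun c => ?_
      · split_ifs
        exacts [le_rfl, hτle _ _ _]
      · split_ifs with h
        exacts [Nat.le_add_right _ _, (hasync2 i _ u hi h).le]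
      · split_ifs with h
        · rw [hx, h]
        · rw [hx, hread i _ h u c rfl]
    have hgrad (i : Fin n) (hi : u ∈ T i) : ‖gradient f (x u) - gradient f (X i u)‖ ^ 2 ≤
        L ^ 2 * (γ ^ 2 * (B * ∑ v ∈ Finset.Ico (u - B) u, ‖s v‖ ^ 2)) := by
      refine (pow_le_pow_left₀ (norm_nonneg _) (hLip _ _) 2).trans ?_
      rw [mul_pow]
      exact mul_le_mul_of_nonneg_left (hstale i hi) (sq_nonneg L)
    have hcross := sum_mul_le_of_block_norm_sq_le (blk := blk) (A := fun i => u ∈ T i)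
      (D := fun i => gradient f (x u) - gradient f (X i u)) (s := s u) (K := L * γ * B)
      (by positivity) (by positivity) hgrad fun c h => by rw [hs, if_neg h]
    have hinner : inner ℝ (gradient f (x u)) (s u) =
        ∑ c, (gradient f (x u) - gradient f (X (blk c) u)) c * s u c - ‖s u‖ ^ 2 := by
      rw [EuclideanSpace.real_norm_sq_eq, ← Finset.sum_sub_distrib, PiLp.inner_apply]
      refine Finset.sum_congr rfl fun c _ => ?_
      simp only [PiLp.sub_apply, hs, RCLike.inner_apply, conj_trivial]
      split_ifs <;> ring
    have h := descent_of_lipschitz_gradient hdiff hLip (x u) (γ • s u)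
    rw [← hstep, inner_smul_right, norm_smul, mul_pow, Real.norm_of_nonneg hγ.le, hinner] at h
    have hmul := mul_le_mul_of_nonneg_left hcross hγ.le
    refine h.trans ?_
    have hrw : γ * (n * (L ^ 2 * (γ ^ 2 * (B * ∑ v ∈ Finset.Ico (u - B) u, ‖s v‖ ^ 2))) /
          (2 * (L * γ * B)) + L * γ * B / 2 * ‖s u‖ ^ 2) =
        L / 2 * n * (γ ^ 2 * ∑ v ∈ Finset.Ico (u - B) u, ‖s v‖ ^ 2) +
          L / 2 * B * (γ ^ 2 * ‖s u‖ ^ 2) := by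
      field_simp
    have hγs : γ⁻¹ * (γ ^ 2 * ‖s u‖ ^ 2) = γ * ‖s u‖ ^ 2 := by
      field_simp
    rw [hrw] at hmul
    linarith
  have hbeta_shift : beta (t + B) = γ ^ 2 * ∑ v ∈ Finset.Ico t (t + B), ‖s v‖ ^ 2 := by
    rw [hbeta, Nat.add_sub_cancel]
  have htelescope : f (x (t + B)) - f (x t) ≤
      -((γ⁻¹ - L / 2 * (B + 1)) * beta (t + B)) +
      L / 2 * n * (γ ^ 2 * ∑ u ∈ Finset.Ico t (t + B),
        ∑ v ∈ Finset.Ico (u - B) u, ‖s v‖ ^ 2) := by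
    rw [← Finset.sum_Ico_sub (fun u => f (x u)) (Nat.le_add_right t B), hbeta_shift]
    simp only [Finset.mul_sum]
    rw [← Finset.sum_neg_distrib, ← Finset.sum_add_distrib]
    refine Finset.sum_le_sum fun u _ => ?_
    have h := hdescent u
    simp only [Finset.mul_sum] at h
    linarith
  have hwindow : L / 2 * n * (γ ^ 2 * ∑ u ∈ Finset.Ico t (t + B),
      ∑ v ∈ Finset.Ico (u - B) u, ‖s v‖ ^ 2) ≤ L / 2 * n * B * (beta t + beta (t + B)) := by
    have h := mul_le_mul_of_nonneg_left
      (sum_window_le (fun v => sq_nonneg ‖s v‖) B t)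
      (by positivity : 0 ≤ L / 2 * n * γ ^ 2)
    rw [hbeta_shift, hbeta t]
    linarith
  have hden : 0 < γ⁻¹ - L * (((B : ℝ) / 2) * ((n : ℝ) + 1) + 1) - (L / 2) * (n : ℝ) * (B : ℝ) := by
    have h := (lt_one_div hγ (by positivity)).1 hγ13
    rw [one_div] at h
    linarith
  have hbeta_nonneg : 0 ≤ beta (t + B) := by
    rw [hbeta_shift]
    positivity
  have hslack : 0 ≤ (L / 2 * n * B + L / 2) * beta (t + B) := by positivity
  rw [le_div_iff₀ hden, halpha]
  linarith [hmin (x (t + B))]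
end

section
/- The nonconvex function f : ℝ → ℝ given by f(x) = x² + 3 sin²(x) satisfies the PL inequality with constant μ = 1/32: for all x ∈ ℝ, (1/2)(f'(x))² ≥ (1/32)(f(x) − f*), where f* = 0 is the minimum value of f (attained at x = 0). -/
open scoped BigOperators

theorem neg_div_four_le_sin {y : ℝ} (hy : 0 ≤ y) : -(y / 4) ≤ Real.sin y := by
  rcases le_total y Real.pi with h | h
  · linarith [Real.sin_nonneg_of_nonneg_of_le_pi hy h]
  rcases le_total y 4 with h4 | h4
  · have h1 := Real.sin_le (sub_nonneg.2 h)
    rw [Real.sin_sub_pi] at h1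
    linarith [Real.pi_gt_three]
  · linarith [Real.neg_one_le_sin y]

theorem sq_div_four_le_sq_add_sin (x : ℝ) :
    x ^ 2 / 4 ≤ (2 * x + 3 * Real.sin (2 * x)) ^ 2 := by
  have key {x : ℝ} (hx : 0 ≤ x) : x ^ 2 / 4 ≤ (2 * x + 3 * Real.sin (2 * x)) ^ 2 := by
    have h := neg_div_four_le_sin (y := 2 * x) (by positivity)
    calc x ^ 2 / 4 = (x / 2) ^ 2 := by ring
      _ ≤ _ := pow_le_pow_left₀ (by positivity) (by linarith) 2
  rcases le_total 0 x with hx | hx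
  · exact key hx
  · have h := key (neg_nonneg.2 hx)
    rw [mul_neg, Real.sin_neg] at h
    linarith

theorem hasDerivAt_sq_add_three_mul_sin_sq (x : ℝ) :
    HasDerivAt (fun x ↦ x ^ 2 + 3 * Real.sin x ^ 2) (2 * x + 3 * Real.sin (2 * x)) x := by
  refine ((hasDerivAt_pow 2 x).add (((Real.hasDerivAt_sin x).pow 2).const_mul 3)).congr_deriv ?_
  rw [Real.sin_two_mul]
  norm_num

theorem example_function_is_pl
    (f : ℝ → ℝ) (hf : ∀ x, f x = x ^ 2 + 3 * Real.sin x ^ 2) :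
    (∀ x, (1 / 32) * (f x - 0) ≤ (1 / 2) * (deriv f x) ^ 2) ∧
    (∀ x, 0 ≤ f x) ∧ f 0 = 0 := by
  obtain rfl : f = fun x ↦ x ^ 2 + 3 * Real.sin x ^ 2 := funext hf
  refine ⟨fun x ↦ ?_, fun x ↦ by positivity, by simp⟩
  rw [(hasDerivAt_sq_add_three_mul_sin_sq x).deriv]
  have h : Real.sin x ^ 2 ≤ x ^ 2 := sq_le_sq.2 Real.abs_sin_le_abs
  linarith [sq_div_four_le_sq_add_sin x]
end
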